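/- arXiv:2510.21617 — 12 statements merged into one kernel-verified Lean document; each statement's English description precedes it below -/
import Mathlib

section
/- Let H be a real inner product space and L > 0. Let x_prev, z, x_0, x_star, g_prev, g ∈ H, f_prev, f_new, f_star ∈ ℝ, and τ̂ ≥ 0. Define τ = τ̂ + 1 + √(1 + 2τ̂), x_new = (τ̂/τ)(x_prev − (1/L)g_prev) + ((τ − τ̂)/τ) z, and z_new = z − ((τ − τ̂)/L) g. Then the identity τ (f_star − f_new + (1/(2L))‖g‖²) + (L/2)‖x_0 − x_star‖² − (L/2)‖z_new − x_star‖² = [ τ̂ (f_star − f_prev + (1/(2L))‖g_prev‖²) + (L/2)‖x_0 − x_star‖² − (L/2)‖z − x_star‖² ] + τ̂ · Q_prev,new(L) + (τ − τ̂) · Q_star,new(L) holds for all values of the free variables, where Q_prev,new(L) = f_prev − f_new − ⟨g, x_prev − x_new⟩ − (1/(2L))‖g_prev − g‖² and Q_star,new(L) = f_star − f_new − ⟨g, x_star − x_new⟩ − (1/(2L))‖g‖². -/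
open scoped RealInnerProductSpace

/-- Inductive step of the Optimized Gradient Method (non-final step):
the maintained quantity H equals the previous H plus τ̂·Q_prev,new(L) plus (τ−τ̂)·Q_star,new(L). -/
theorem ogm_inductive_step {H : Type*} [NormedAddCommGroup H] [InnerProductSpace ℝ H]
    (L : ℝ) (hL : 0 < L)
    (xprev z x₀ xstar gprev g : H) (fprev fnew fstar : ℝ)
    (tauh : ℝ) (htauh : 0 ≤ tauh)
    (tau : ℝ) (htau : tau = tauh + 1 + Real.sqrt (1 + 2 * tauh))
    (xnew znew : H)
    (hx : xnew = (tauh / tau) • (xprev - (1 / L) • gprev) + ((tau - tauh) / tau) • z)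
    (hz : znew = z - ((tau - tauh) / L) • g) :
    tau * (fstar - fnew + (1 / (2 * L)) * ‖g‖ ^ 2)
      + (L / 2) * ‖x₀ - xstar‖ ^ 2 - (L / 2) * ‖znew - xstar‖ ^ 2
    = (tauh * (fstar - fprev + (1 / (2 * L)) * ‖gprev‖ ^ 2)
        + (L / 2) * ‖x₀ - xstar‖ ^ 2 - (L / 2) * ‖z - xstar‖ ^ 2)
      + tauh * (fprev - fnew - ⟪g, xprev - xnew⟫ - (1 / (2 * L)) * ‖gprev - g‖ ^ 2)
      + (tau - tauh) * (fstar - fnew - ⟪g, xstar - xnew⟫ - (1 / (2 * L)) * ‖g‖ ^ 2) := by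
  have hs : Real.sqrt (1 + 2 * tauh) ^ 2 = 1 + 2 * tauh := Real.sq_sqrt (by positivity)
  have htau_pos : 0 < tau := by rw [htau]; positivity
  have hstep : (tau - tauh) ^ 2 = 2 * tau := by
    rw [htau]; linear_combination hs
  have hinner : tau * ⟪g, xnew⟫ =
      tauh * (⟪g, xprev⟫ - 1 / L * ⟪g, gprev⟫) + (tau - tauh) * ⟪g, z⟫ := by
    rw [hx]
    simp only [inner_add_right, inner_sub_right, real_inner_smul_right]
    field_simp
  have hnorm : ‖znew - xstar‖ ^ 2 = ‖z - xstar‖ ^ 2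
      - 2 * ((tau - tauh) / L) * (⟪g, z⟫ - ⟪g, xstar⟫) + ((tau - tauh) / L) ^ 2 * ‖g‖ ^ 2 := by
    rw [hz, sub_right_comm, norm_sub_sq_real, real_inner_smul_right, norm_smul, mul_pow,
      Real.norm_eq_abs, sq_abs, real_inner_comm, inner_sub_right]
    ring
  rw [hnorm, norm_sub_sq_real gprev g, real_inner_comm g gprev, inner_sub_right, inner_sub_right,
    div_pow, hstep]
  have hL' : L ≠ 0 := hL.ne'
  field_simp at hinner ⊢
  linear_combination (-2) * hinner
end

section
/- Let H be a real inner product space and L > 0. Let x_prev, z, x_0, x_star, g_prev, g ∈ H, f_prev, f_new, f_star ∈ ℝ, and τ̂ ≥ 0. Define τ = τ̂ + (1 + √(1 + 4τ̂))/2, x_new = (τ̂/τ)(x_prev − (1/L)g_prev) + ((τ − τ̂)/τ) z, and z_new = z − ((τ − τ̂)/L) g. Then τ (f_star − f_new) + (L/2)‖x_0 − x_star‖² − (L/2)‖z_new − x_star‖² = [ τ̂ (f_star − f_prev + (1/(2L))‖g_prev‖²) + (L/2)‖x_0 − x_star‖² − (L/2)‖z − x_star‖² ] + τ̂ · Q_prev,new(L)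 + (τ − τ̂) · Q_star,new(L), where Q_prev,new(L) = f_prev − f_new − ⟨g, x_prev − x_new⟩ − (1/(2L))‖g_prev − g‖² and Q_star,new(L) = f_star − f_new − ⟨g, x_star − x_new⟩ − (1/(2L))‖g‖². Consequently, if the bracketed quantity and both Q-terms are nonnegative and τ > 0, then f_new − f_star ≤ (L/(2τ))‖x_0 − x_star‖². -/
open scoped RealInnerProductSpace

/-- Final-step version of the OGM induction, together with the resulting convergence bound. -/
theorem ogm_final_step {H : Type*} [NormedAddCommGroup H] [InnerProductSpace ℝ H]
    (L : ℝ) (hL : 0 < L)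
    (xprev z x₀ xstar gprev g : H) (fprev fnew fstar : ℝ)
    (tauh : ℝ) (htauh : 0 ≤ tauh)
    (tau : ℝ) (htau : tau = tauh + (1 + Real.sqrt (1 + 4 * tauh)) / 2)
    (xnew znew : H)
    (hx : xnew = (tauh / tau) • (xprev - (1 / L) • gprev) + ((tau - tauh) / tau) • z)
    (hz : znew = z - ((tau - tauh) / L) • g) :
    (tau * (fstar - fnew)
        + (L / 2) * ‖x₀ - xstar‖ ^ 2 - (L / 2) * ‖znew - xstar‖ ^ 2
      = (tauh * (fstar - fprev + (1 / (2 * L)) * ‖gprev‖ ^ 2)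
          + (L / 2) * ‖x₀ - xstar‖ ^ 2 - (L / 2) * ‖z - xstar‖ ^ 2)
        + tauh * (fprev - fnew - ⟪g, xprev - xnew⟫ - (1 / (2 * L)) * ‖gprev - g‖ ^ 2)
        + (tau - tauh) * (fstar - fnew - ⟪g, xstar - xnew⟫ - (1 / (2 * L)) * ‖g‖ ^ 2))
    ∧ (0 ≤ tauh * (fstar - fprev + (1 / (2 * L)) * ‖gprev‖ ^ 2)
          + (L / 2) * ‖x₀ - xstar‖ ^ 2 - (L / 2) * ‖z - xstar‖ ^ 2 →
        0 ≤ fprev - fnew - ⟪g, xprev - xnew⟫ - (1 / (2 * L)) * ‖gprev - g‖ ^ 2 →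
        0 ≤ fstar - fnew - ⟪g, xstar - xnew⟫ - (1 / (2 * L)) * ‖g‖ ^ 2 →
        0 < tau →
        fnew - fstar ≤ (L / (2 * tau)) * ‖x₀ - xstar‖ ^ 2) := by
  have hsq : Real.sqrt (1 + 4 * tauh) ^ 2 = 1 + 4 * tauh := Real.sq_sqrt (by linarith)
  have htau_pos : 0 < tau := by
    rw [htau]
    positivity
  have hstep : (tau - tauh) ^ 2 = tau := by
    rw [htau]
    linear_combination hsq / 4
  have hinner : tau * ⟪g, xnew⟫
      = tauh * ⟪g, xprev⟫ - tauh / L * ⟪g, gprev⟫ + (tau - tauh) * ⟪g, z⟫ := by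
    rw [hx]
    simp only [inner_add_right, inner_sub_right, real_inner_smul_right]
    field_simp
  have hznorm : ‖znew - xstar‖ ^ 2 = ‖z - xstar‖ ^ 2
      - 2 * ((tau - tauh) / L) * (⟪g, z⟫ - ⟪g, xstar⟫) + tau / L ^ 2 * ‖g‖ ^ 2 := by
    rw [hz, sub_right_comm, norm_sub_sq_real, real_inner_smul_right, real_inner_comm,
      inner_sub_right, norm_smul, mul_pow, Real.norm_eq_abs, sq_abs, div_pow, hstep]
    ring
  have hidentity : tau * (fstar - fnew)
        + (L / 2) * ‖x₀ - xstar‖ ^ 2 - (L / 2) * ‖znew - xstar‖ ^ 2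
      = (tauh * (fstar - fprev + (1 / (2 * L)) * ‖gprev‖ ^ 2)
          + (L / 2) * ‖x₀ - xstar‖ ^ 2 - (L / 2) * ‖z - xstar‖ ^ 2)
        + tauh * (fprev - fnew - ⟪g, xprev - xnew⟫ - (1 / (2 * L)) * ‖gprev - g‖ ^ 2)
        + (tau - tauh) * (fstar - fnew - ⟪g, xstar - xnew⟫ - (1 / (2 * L)) * ‖g‖ ^ 2) := by
    rw [hznorm, norm_sub_sq_real gprev g, inner_sub_right, inner_sub_right,
      real_inner_comm g gprev]
    have hcancel : L * L⁻¹ = 1 := mul_inv_cancel₀ hL.ne'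
    linear_combination -hinner + ((tau - tauh) * (⟪g, z⟫ - ⟪g, xstar⟫)
      - tau / (2 * L) * ‖g‖ ^ 2) * hcancel
  refine ⟨hidentity, fun hprev hQprev hQstar _ => ?_⟩
  have hstep_nonneg : 0 ≤ tau - tauh := by
    rw [htau, add_sub_cancel_left]
    positivity
  have hbound : tau * (fnew - fstar) ≤ L / 2 * ‖x₀ - xstar‖ ^ 2 := by
    have hznew : 0 ≤ L / 2 * ‖znew - xstar‖ ^ 2 := by positivity
    linarith [mul_nonneg htauh hQprev, mul_nonneg hstep_nonneg hQstar]
  calc fnew - fstar ≤ (L / 2 * ‖x₀ - xstar‖ ^ 2) / tau := by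
        rwa [le_div_iff₀' htau_pos]
    _ = L / (2 * tau) * ‖x₀ - xstar‖ ^ 2 := by
        field_simp
end

section
/- Let H be a real inner product space, L_prev > 0, L > 0. Let x_prev, z, x_0, x_star, g_prev, g ∈ H, f_prev, f_new, f_star ∈ ℝ, τ̂ ≥ 0, and Δ̂ ∈ ℝ. Define δ = L τ̂ (1/L_prev² − 1/L²) (1/2)‖g_prev‖², τ = τ̂ + (1 + √(1 + 8τ̂))/2, x_new = (τ̂/τ)(x_prev − (1/L)g_prev) + ((τ − τ̂)/τ) z, z_new = z − ((τ − τ̂)/L) g, and Δ = (L/L_prev)Δ̂ + δ. Then U_new = (L/L_prev) U_prev + τ̂ · Q_prev,new(L) + (τ − τ̂) · W_star,new + τ̂ ((L/L_prev) − 1)(f_prev − f_star), as an identity in all free variables, where U_new = τ (f_star − f_new + (1/(2L))‖g‖²) + (L/2)‖x_0 − x_star‖² − (L/2)‖z_new − x_star‖² + Δ, U_prev = τ̂ (f_star − f_prev + (1/(2L_prev))‖g_prev‖²) + (L_prev/2)‖x_0 − x_star‖² − (L_prev/2)‖z − x_star‖² + Δ̂, Q_prev,new(L) = f_prev − f_new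 − ⟨g, x_prev − x_new⟩ − (1/(2L))‖g_prev − g‖², and W_star,new = f_star − f_new − ⟨g, x_star − x_new⟩. -/
open scoped RealInnerProductSpace

/-- One-step induction identity underlying the Optimized Backtracking Linesearch (OBL) method. -/
theorem obl_inductive_step {H : Type*} [NormedAddCommGroup H] [InnerProductSpace ℝ H]
    (Lprev L : ℝ) (hLprev : 0 < Lprev) (hL : 0 < L)
    (xprev z x₀ xstar gprev g : H) (fprev fnew fstar : ℝ)
    (tauh : ℝ) (htauh : 0 ≤ tauh) (Deltah : ℝ)
    (delta : ℝ) (hdelta : delta = L * tauh * (1 / Lprev ^ 2 - 1 / L ^ 2) * ((1 / 2) * ‖gprev‖ ^ 2))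
    (tau : ℝ) (htau : tau = tauh + (1 + Real.sqrt (1 + 8 * tauh)) / 2)
    (xnew znew : H)
    (hx : xnew = (tauh / tau) • (xprev - (1 / L) • gprev) + ((tau - tauh) / tau) • z)
    (hz : znew = z - ((tau - tauh) / L) • g)
    (Delta : ℝ) (hDelta : Delta = (L / Lprev) * Deltah + delta) :
    tau * (fstar - fnew + (1 / (2 * L)) * ‖g‖ ^ 2)
        + (L / 2) * ‖x₀ - xstar‖ ^ 2 - (L / 2) * ‖znew - xstar‖ ^ 2 + Delta
    = (L / Lprev) * (tauh * (fstar - fprev + (1 / (2 * Lprev)) * ‖gprev‖ ^ 2)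
          + (Lprev / 2) * ‖x₀ - xstar‖ ^ 2 - (Lprev / 2) * ‖z - xstar‖ ^ 2 + Deltah)
      + tauh * (fprev - fnew - ⟪g, xprev - xnew⟫ - (1 / (2 * L)) * ‖gprev - g‖ ^ 2)
      + (tau - tauh) * (fstar - fnew - ⟪g, xstar - xnew⟫)
      + tauh * ((L / Lprev) - 1) * (fprev - fstar) := by
  have hs : Real.sqrt (1 + 8 * tauh) ^ 2 = 1 + 8 * tauh := Real.sq_sqrt (by linarith)
  have htau_pos : 0 < tau := by
    rw [htau]
    positivity
  have hstep : (tau - tauh) ^ 2 = tau + tauh := by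
    rw [htau]
    linear_combination hs / 4
  have hxg : tau * ⟪g, xnew⟫
      = tauh * (⟪g, xprev⟫ - (1 / L) * ⟪g, gprev⟫) + (tau - tauh) * ⟪g, z⟫ := by
    rw [hx, inner_add_right, real_inner_smul_right, real_inner_smul_right, inner_sub_right,
      real_inner_smul_right]
    field_simp
  have hznorm : ‖znew - xstar‖ ^ 2 = ‖z - xstar‖ ^ 2
      - 2 * ((tau - tauh) / L) * (⟪g, z⟫ - ⟪g, xstar⟫) + (tau + tauh) / L ^ 2 * ‖g‖ ^ 2 := by
    rw [hz, sub_right_comm, norm_sub_sq_real, real_inner_smul_right, real_inner_comm,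
      inner_sub_right, norm_smul, mul_pow, Real.norm_eq_abs, sq_abs, div_pow, hstep]
    ring
  rw [hznorm, hDelta, hdelta, norm_sub_sq_real gprev g, real_inner_comm g gprev,
    inner_sub_right, inner_sub_right]
  field_simp at hxg ⊢
  linear_combination (-2 * Lprev ^ 2) * hxg
end

section
/- For every natural number n and every real τ̂ with τ̂ ≥ n²/2, one has τ̂ + (1 + √(1 + 8 τ̂))/2 ≥ (n+1)²/2. Consequently, any real sequence (τ_k) with τ_0 ≥ 0 and τ_k ≥ τ_{k−1} + (1 + √(1 + 8 τ_{k−1}))/2 for all k ≥ 1 satisfies τ_k ≥ k²/2 for all k, i.e., it grows at least quadratically. -/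
/-- One τ-update step carries the lower bound `x ^ 2 / 2` to `(x + 1) ^ 2 / 2`. -/
theorem sq_half_le_tau_update {x t : ℝ} (h : x ^ 2 / 2 ≤ t) :
    (x + 1) ^ 2 / 2 ≤ t + (1 + Real.sqrt (1 + 8 * t)) / 2 := by
  have hs : 2 * x ≤ Real.sqrt (1 + 8 * t) := Real.le_sqrt_of_sq_le (by linarith)
  linarith

/-- The τ-update of OBL/BSPGM grows at least quadratically: one step preserves
the bound τ ≥ n²/2, and consequently any sequence dominated from below by the
update satisfies τ_k ≥ k²/2 for all k. -/
theorem tau_quadratic_growth :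
    (∀ (n : ℕ) (tauh : ℝ), (n : ℝ) ^ 2 / 2 ≤ tauh →
      ((n : ℝ) + 1) ^ 2 / 2 ≤ tauh + (1 + Real.sqrt (1 + 8 * tauh)) / 2) ∧
    (∀ tau : ℕ → ℝ, 0 ≤ tau 0 →
      (∀ k : ℕ, 1 ≤ k →
        tau (k - 1) + (1 + Real.sqrt (1 + 8 * tau (k - 1))) / 2 ≤ tau k) →
      ∀ k : ℕ, (k : ℝ) ^ 2 / 2 ≤ tau k) := by
  refine ⟨fun n t h => sq_half_le_tau_update h, fun tau h0 hstep k => ?_⟩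
  induction k with
  | zero => simpa using h0
  | succ k ih =>
    have hk := hstep (k + 1) (Nat.le_add_left 1 k)
    rw [Nat.add_sub_cancel] at hk
    push_cast
    exact (sq_half_le_tau_update ih).trans hk
end

section
/- Define F(t) = t + (1 + √(1 + 8t))/2 and G(t) = t + √t for t ≥ 0; both F and G are nondecreasing on [0, ∞). Let N ≥ 1 and let reals τ_0, …, τ_N satisfy τ_0 ≥ 1, τ_i ≥ F(τ_{i−1}) for 1 ≤ i ≤ N−1, and τ_N ≥ G(τ_{N−1}). For 0 ≤ n ≤ N define the completion sequence τ_{n,i} by τ_{n,n} = τ_n, τ_{n,i} = F(τ_{n,i−1}) for n < i ≤ N−1, and τ_{n,N} = G(τ_{n,N−1}) when n < N. Then all τ_{n,N} are positive and τ_{N,N} ≥ τ_{N−1,N} ≥ … ≥ τ_{1,N} ≥ τ_{0,N}; equivalently 1/τ_{N,N} ≤ 1/τ_{N−1,N} ≤ … ≤ 1/τ_{0,N}. Moreover, if τ_0 = 1 then τ_{0,N} = ( N(N+1) + √(2 N(N+1)) )/2. -/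
/-- The non-final update maps the triangular number `(i + 1)(i + 2) / 2` to the next one. -/
lemma triangular_add_sqrt (i : ℕ) :
    ((i : ℝ) + 1) * (i + 2) / 2 + (1 + √(1 + 8 * (((i : ℝ) + 1) * (i + 2) / 2))) / 2 =
      ((i : ℝ) + 2) * (i + 3) / 2 := by
  have h : 1 + 8 * (((i : ℝ) + 1) * (i + 2) / 2) = (2 * i + 3) ^ 2 := by ring
  rw [h, Real.sqrt_sq (by positivity)]
  ring

lemma half_add_sqrt_half (x : ℝ) : x / 2 + √(x / 2) = (x + √(2 * x)) / 2 := by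
  have h : 2 * x = 2 ^ 2 * (x / 2) := by ring
  rw [h, Real.sqrt_mul (by positivity), Real.sqrt_sq (by positivity)]
  ring

/-- Dynamic guarantees of BSPGM (Theorem 3): the OBL completion values
τ_{n,N} are positive and monotone in n, giving the chain of dynamic bounds,
and τ_{0,N} has the closed form (N(N+1) + √(2N(N+1)))/2 when τ₀ = 1. -/
theorem bspgm_dynamic_guarantees (F G : ℝ → ℝ)
    (hF : ∀ t : ℝ, F t = t + (1 + Real.sqrt (1 + 8 * t)) / 2)
    (hG : ∀ t : ℝ, G t = t + Real.sqrt t)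
    (N : ℕ) (hN : 1 ≤ N)
    (tau : ℕ → ℝ) (htau0 : 1 ≤ tau 0)
    (htaustep : ∀ i : ℕ, 1 ≤ i → i ≤ N - 1 → F (tau (i - 1)) ≤ tau i)
    (htauN : G (tau (N - 1)) ≤ tau N)
    (tauc : ℕ → ℕ → ℝ)
    (hcdiag : ∀ n : ℕ, n ≤ N → tauc n n = tau n)
    (hcstep : ∀ n i : ℕ, n < i → i ≤ N - 1 → tauc n i = F (tauc n (i - 1)))
    (hcN : ∀ n : ℕ, n < N → tauc n N = G (tauc n (N - 1))) :
    MonotoneOn F (Set.Ici (0 : ℝ)) ∧ MonotoneOn G (Set.Ici (0 : ℝ)) ∧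
    (∀ n : ℕ, n ≤ N → 0 < tauc n N) ∧
    (∀ n : ℕ, n + 1 ≤ N → tauc n N ≤ tauc (n + 1) N) ∧
    (∀ n : ℕ, n + 1 ≤ N → 1 / tauc (n + 1) N ≤ 1 / tauc n N) ∧
    (tau 0 = 1 →
      tauc 0 N = ((N : ℝ) * ((N : ℝ) + 1) + Real.sqrt (2 * (N : ℝ) * ((N : ℝ) + 1))) / 2) := by
  obtain ⟨M, rfl⟩ : ∃ M, N = M + 1 := ⟨N - 1, by omega⟩
  simp only [Nat.add_sub_cancel] at *
  have hFmono : Monotone F := fun a b hab => by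
    rw [hF, hF]
    gcongr
  have hGmono : Monotone G := fun a b hab => by
    rw [hG, hG]
    gcongr
  have hFle (t : ℝ) : t ≤ F t := by
    rw [hF]
    exact le_add_of_nonneg_right (by positivity)
  have hGle (t : ℝ) : t ≤ G t := by
    rw [hG]
    exact le_add_of_nonneg_right (by positivity)
  have hstep (n i : ℕ) (hni : n ≤ i) (hi : i + 1 ≤ M) : tauc n (i + 1) = F (tauc n i) :=
    hcstep n (i + 1) (by omega) hi
  have htau (i : ℕ) (hi : i ≤ M) : 1 ≤ tau i := by
    induction i with
    | zero => exact htau0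
    | succ i ih => exact (ih (by omega)).trans ((hFle _).trans (htaustep (i + 1) (by omega) hi))
  have htauc (n i : ℕ) (hni : n ≤ i) (hi : i ≤ M) : 1 ≤ tauc n i := by
    induction i, hni using Nat.le_induction with
    | base => exact (htau n hi).trans_eq (hcdiag n (by omega)).symm
    | succ i hni ih =>
      rw [hstep n i hni hi]
      exact (ih (by omega)).trans (hFle _)
  have hmono (n i : ℕ) (hni : n + 1 ≤ i) (hi : i ≤ M) : tauc n i ≤ tauc (n + 1) i := by
    induction i, hni using Nat.le_induction with
    | base =>
      rw [hstep n n le_rfl hi, hcdiag n (by omega), hcdiag (n + 1) (by omega)]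
      exact htaustep (n + 1) (by omega) hi
    | succ i hni ih =>
      rw [hstep n i (by omega) hi, hstep (n + 1) i hni hi]
      exact hFmono (ih (by omega))
  have hpos (n : ℕ) (hn : n ≤ M + 1) : 0 < tauc n (M + 1) := by
    rcases hn.eq_or_lt with rfl | hlt
    · rw [hcdiag _ le_rfl]
      linarith [htau M le_rfl, hGle (tau M)]
    · rw [hcN n hlt]
      linarith [htauc n M (by omega) le_rfl, hGle (tauc n M)]
  have hchain (n : ℕ) (hn : n + 1 ≤ M + 1) : tauc n (M + 1) ≤ tauc (n + 1) (M + 1) := by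
    rcases hn.eq_or_lt with heq | hlt
    · obtain rfl : n = M := by omega
      rwa [hcN n (by omega), hcdiag n (by omega), hcdiag (n + 1) le_rfl]
    · rw [hcN n (by omega), hcN (n + 1) hlt]
      exact hGmono (hmono n M (by omega) le_rfl)
  refine ⟨hFmono.monotoneOn _, hGmono.monotoneOn _, hpos, hchain,
    fun n hn => one_div_le_one_div_of_le (hpos n (by omega)) (hchain n hn), fun h0 => ?_⟩
  have hclosed (i : ℕ) (hi : i ≤ M) : tauc 0 i = ((i : ℝ) + 1) * (i + 2) / 2 := by
    induction i with
    | zero => simp [hcdiag, h0]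
    | succ i ih =>
      rw [hstep 0 i (by omega) hi, ih (by omega), hF, triangular_add_sqrt]
      push_cast
      ring
  rw [hcN 0 (by omega), hclosed M le_rfl, hG, half_add_sqrt_half]
  push_cast
  ring_nf
end

section
/- Let H be a real inner product space, k ≥ 1 an integer, L_n > 0, and for each i in the finite index set I = {1, …, k} let x_i, g_i, z_i ∈ H, f_i ∈ ℝ, τ_i ∈ ℝ, L_i > 0, and Δ_i ∈ ℝ. Fix x_0 ∈ H, an index m ∈ I, a real δ, and arbitrary vectors ρ, γ ∈ ℝ^k. Define v_i = f_i − ‖g_i‖²/(2 L_n); a_i = τ_i (f_i − ‖g_i‖²/(2 L_i)) + (L_i/2)‖z_i‖² − (L_i/2)‖x_0‖² − v_m τ_i − ⟨L_i (z_i − x_0), x_0⟩; b_i = f_i − ⟨g_i, x_i − x_0⟩ − v_m; z' = x_0 + Σ_i ρ_i (L_i/L_n)(z_i − x_0) − Σ_i γ_i g_i / L_n; τ' = Σ_i ρ_i τ_i + Σ_i γ_i; Δ' = Σ_i ρ_i Δ_i; and ε = Σ_i ρ_i a_i + Σ_i γ_i b_i + δ − (L_n/2)‖Σ_i ρ_i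 (L_i/L_n)(z_i − x_0) − Σ_i γ_i g_i / L_n‖². Then for every x_star ∈ H and f_star ∈ ℝ: τ' (f_star − f_m + ‖g_m‖²/(2 L_n)) + (L_n/2)‖x_0 − x_star‖² − (L_n/2)‖z' − x_star‖² + Δ' + δ = Σ_i ρ_i U_i + Σ_i γ_i W_i + ε, where U_i = τ_i (f_star − f_i + ‖g_i‖²/(2 L_i)) + (L_i/2)‖x_0 − x_star‖² − (L_i/2)‖z_i − x_star‖² + Δ_i and W_i = f_star − f_i − ⟨g_i, x_star − x_i⟩. -/
open scoped RealInnerProductSpace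

/-- The aggregation identity underlying BSPGM's dynamically optimized inductive
hypothesis U′: the strengthened hypothesis equals the combination
Σ ρᵢ Uᵢ + Σ γᵢ Wᵢ + ε of past inductive quantities, convexity quantities, and slack. -/
theorem bspgm_aggregation_identity {H : Type*} [NormedAddCommGroup H] [InnerProductSpace ℝ H]
    (k : ℕ) (hk : 1 ≤ k)
    (Ln : ℝ) (hLn : 0 < Ln)
    (x g z : Fin k → H) (f tau L Delta : Fin k → ℝ) (hL : ∀ i, 0 < L i)
    (x₀ : H) (m : Fin k) (delta : ℝ) (rho gamma : Fin k → ℝ)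
    (v a b : Fin k → ℝ)
    (hv : ∀ i, v i = f i - ‖g i‖ ^ 2 / (2 * Ln))
    (ha : ∀ i, a i = tau i * (f i - ‖g i‖ ^ 2 / (2 * L i))
        + (L i / 2) * ‖z i‖ ^ 2 - (L i / 2) * ‖x₀‖ ^ 2
        - v m * tau i - ⟪(L i) • (z i - x₀), x₀⟫)
    (hb : ∀ i, b i = f i - ⟪g i, x i - x₀⟫ - v m)
    (z' : H)
    (hz' : z' = x₀ + ∑ i, rho i • ((L i / Ln) • (z i - x₀))
        - ∑ i, gamma i • ((1 / Ln) • g i))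
    (tau' : ℝ) (htau' : tau' = ∑ i, rho i * tau i + ∑ i, gamma i)
    (Delta' : ℝ) (hDelta' : Delta' = ∑ i, rho i * Delta i)
    (eps : ℝ)
    (heps : eps = ∑ i, rho i * a i + ∑ i, gamma i * b i + delta
        - (Ln / 2) * ‖(∑ i, rho i • ((L i / Ln) • (z i - x₀)))
            - ∑ i, gamma i • ((1 / Ln) • g i)‖ ^ 2) :
    ∀ (xstar : H) (fstar : ℝ),
      tau' * (fstar - f m + ‖g m‖ ^ 2 / (2 * Ln))
          + (Ln / 2) * ‖x₀ - xstar‖ ^ 2 - (Ln / 2) * ‖z' - xstar‖ ^ 2 + Delta' + delta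
      = (∑ i, rho i * (tau i * (fstar - f i + ‖g i‖ ^ 2 / (2 * L i))
            + (L i / 2) * ‖x₀ - xstar‖ ^ 2 - (L i / 2) * ‖z i - xstar‖ ^ 2 + Delta i))
        + (∑ i, gamma i * (fstar - f i - ⟪g i, xstar - x i⟫))
        + eps := by
  intro xstar fstar
  have hU : ∀ i, rho i * (tau i * (fstar - f i + ‖g i‖ ^ 2 / (2 * L i))
        + (L i / 2) * ‖x₀ - xstar‖ ^ 2 - (L i / 2) * ‖z i - xstar‖ ^ 2 + Delta i)
      = rho i * tau i * (fstar - v m) + rho i * Delta i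
        - rho i * (L i * ⟪z i - x₀, x₀ - xstar⟫) - rho i * a i := by
    intro i
    rw [ha, norm_sub_sq_real, norm_sub_sq_real]
    simp only [inner_sub_left, inner_sub_right, real_inner_smul_left, real_inner_self_eq_norm_sq]
    ring
  have hW : ∀ i, gamma i * (fstar - f i - ⟪g i, xstar - x i⟫)
      = gamma i * (fstar - v m) + gamma i * ⟪g i, x₀ - xstar⟫ - gamma i * b i := by
    intro i
    rw [hb]
    simp only [inner_sub_right]
    ring
  set w := (∑ i, rho i • ((L i / Ln) • (z i - x₀))) - ∑ i, gamma i • ((1 / Ln) • g i) with hw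
  have hinner : Ln * ⟪w, x₀ - xstar⟫ = ∑ i, rho i * (L i * ⟪z i - x₀, x₀ - xstar⟫)
      - ∑ i, gamma i * ⟪g i, x₀ - xstar⟫ := by
    rw [hw, inner_sub_left, sum_inner, sum_inner, mul_sub, Finset.mul_sum, Finset.mul_sum]
    simp only [real_inner_smul_left]
    congr 1 <;> refine Finset.sum_congr rfl fun i _ => ?_ <;> field_simp
  have hnorm : ‖z' - xstar‖ ^ 2
      = ‖w‖ ^ 2 + 2 * ⟪w, x₀ - xstar⟫ + ‖x₀ - xstar‖ ^ 2 := by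
    rw [← norm_add_sq_real, hz', hw]
    congr 2
    abel
  simp only [hU, hW, Finset.sum_sub_distrib, Finset.sum_add_distrib, ← Finset.sum_mul]
  rw [heps, hnorm, htau', hDelta', hv m]
  linear_combination -hinner
end

section
/- Let H be a real inner product space and L > 0. Let x_m, z', x_0, x_star, g_m, g ∈ H, f_m, f_new, f_star ∈ ℝ, Δ'' ∈ ℝ, and τ' ≥ 0. Define either (non-final case) τ = τ' + (1 + √(1 + 8τ'))/2 and σ = 1, or (final case, assuming τ' > 0) τ = τ' + √(τ') and σ = 0. Set α = τ − τ', x_new = (τ'/τ)(x_m − (1/L) g_m) + (α/τ) z', and z_new = z' − (α/L) g. Then U_new = U' + τ' · Q(L) + (τ − τ') · W holds identically in all free variables, where U' = τ' (f_star − f_m + ‖g_m‖²/(2L)) + (L/2)‖x_0 − x_star‖² − (L/2)‖z' − x_star‖² + Δ''; U_new = τ (f_star − f_new + σ · ‖g‖²/(2L)) + (L/2)‖x_0 − x_star‖² − (L/2)‖z_new − x_star‖² + Δ''; Q(L) = f_m − f_new − ⟨g, x_m − x_new⟩ − ‖g_m − g‖²/(2L); and W = f_star − f_new − ⟨g, x_star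 − x_new⟩. -/
open scoped RealInnerProductSpace

/-- The one-step identity by which BSPGM extends its aggregated hypothesis U′ to
the new hypothesis U_new via the OBL update, covering both the non-final case
(σ = 1) and the final case (σ = 0). -/
theorem bspgm_one_step_identity {H : Type*} [NormedAddCommGroup H] [InnerProductSpace ℝ H]
    (L : ℝ) (hL : 0 < L)
    (xm z' x₀ xstar gm g : H) (fm fnew fstar : ℝ) (Delta'' : ℝ)
    (tau' : ℝ) (htau' : 0 ≤ tau')
    (tau sigma : ℝ)
    (hcase : (tau = tau' + (1 + Real.sqrt (1 + 8 * tau')) / 2 ∧ sigma = 1) ∨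
             (0 < tau' ∧ tau = tau' + Real.sqrt tau' ∧ sigma = 0))
    (alpha : ℝ) (halpha : alpha = tau - tau')
    (xnew znew : H)
    (hx : xnew = (tau' / tau) • (xm - (1 / L) • gm) + (alpha / tau) • z')
    (hz : znew = z' - (alpha / L) • g) :
    tau * (fstar - fnew + sigma * (‖g‖ ^ 2 / (2 * L)))
        + (L / 2) * ‖x₀ - xstar‖ ^ 2 - (L / 2) * ‖znew - xstar‖ ^ 2 + Delta''
    = (tau' * (fstar - fm + ‖gm‖ ^ 2 / (2 * L))
          + (L / 2) * ‖x₀ - xstar‖ ^ 2 - (L / 2) * ‖z' - xstar‖ ^ 2 + Delta'')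
      + tau' * (fm - fnew - ⟪g, xm - xnew⟫ - ‖gm - g‖ ^ 2 / (2 * L))
      + (tau - tau') * (fstar - fnew - ⟪g, xstar - xnew⟫) := by
  have htau : 0 < tau := by
    rcases hcase with ⟨h, -⟩ | ⟨hpos, h, -⟩
    · rw [h]; positivity
    · rw [h]; positivity
  have hsq : alpha ^ 2 = tau * sigma + tau' := by
    rcases hcase with ⟨h, hs⟩ | ⟨hpos, h, hs⟩
    · have hroot := Real.sq_sqrt (show 0 ≤ 1 + 8 * tau' by positivity)
      rw [halpha, h, hs]
      linear_combination hroot / 4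
    · have hroot := Real.sq_sqrt hpos.le
      rw [halpha, h, hs]
      linear_combination hroot
  have hinner : tau * ⟪g, xnew⟫ = tau' * (⟪g, xm⟫ - ⟪g, gm⟫ / L) + alpha * ⟪g, z'⟫ := by
    rw [hx]
    simp only [inner_add_right, inner_sub_right, real_inner_smul_right]
    field_simp
  have hznorm : ‖znew - xstar‖ ^ 2 = ‖z' - xstar‖ ^ 2
      - 2 * (alpha / L) * (⟪g, z'⟫ - ⟪g, xstar⟫) + (alpha / L) ^ 2 * ‖g‖ ^ 2 := by
    rw [hz, sub_right_comm, norm_sub_sq_real, real_inner_smul_right, real_inner_comm,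
      inner_sub_right, norm_smul, mul_pow, Real.norm_eq_abs, sq_abs]
    ring
  rw [hznorm, norm_sub_sq_real gm g, real_inner_comm g gm, inner_sub_right, inner_sub_right]
  obtain rfl : tau = tau' + alpha := by linarith
  field_simp
  field_simp at hinner
  linear_combination (-‖g‖ ^ 2) * hsq - 2 * hinner
end

section
/- Let H be a real inner product space. Let τ_s > 0, let L_s, L_n be reals with 0 < L_s ≤ L_n, let f_s ∈ ℝ, g_s, z, x_0 ∈ H, and let v_m ∈ ℝ satisfy v_m ≤ f_s − ‖g_s‖²/(2 L_n). Define a_s = τ_s (f_s − ‖g_s‖²/(2 L_s)) + (L_s/2)‖z‖² − (L_s/2)‖x_0‖² − v_m τ_s − ⟨L_s (z − x_0), x_0⟩ and δ = L_n τ_s (1/L_s² − 1/L_n²)(1/2)‖g_s‖². Then for every c ∈ [0, 1], with κ = c L_n / L_s, one has κ a_s + δ − (L_n/2)‖c (z − x_0)‖² ≥ κ τ_s (v_s − v_m) + τ_s (1/L_s − 1/L_n)(1/2)‖g_s‖² + (L_n (c − c²)/2)‖z − x_0‖² ≥ 0, where v_s = f_s − ‖g_s‖²/(2 L_n). In particular,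 for c = 1 the feasible point (ρ, γ) = (κ e_s, 0) of the BSPGM subproblem attains objective value (L_n/L_s) τ_s ≥ τ_s. -/
open scoped RealInnerProductSpace

/-- Feasibility computation of Lemma 1(i)–(ii): the point (ρ, γ) = (κ e_s, 0)
satisfies the second-order cone constraint of BSPGM's subproblem, with the
stated chain of inequalities, and for c = 1 attains objective value
(L_n/L_s) τ_s ≥ τ_s. -/
theorem bspgm_subproblem_feasibility {H : Type*} [NormedAddCommGroup H] [InnerProductSpace ℝ H]
    (taus : ℝ) (htaus : 0 < taus)
    (Ls Ln : ℝ) (hLs : 0 < Ls) (hLsLn : Ls ≤ Ln)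
    (fs : ℝ) (gs z x₀ : H)
    (vm : ℝ) (hvm : vm ≤ fs - ‖gs‖ ^ 2 / (2 * Ln))
    (as_ : ℝ)
    (has : as_ = taus * (fs - ‖gs‖ ^ 2 / (2 * Ls))
        + (Ls / 2) * ‖z‖ ^ 2 - (Ls / 2) * ‖x₀‖ ^ 2
        - vm * taus - ⟪Ls • (z - x₀), x₀⟫)
    (delta : ℝ)
    (hdelta : delta = Ln * taus * (1 / Ls ^ 2 - 1 / Ln ^ 2) * ((1 / 2) * ‖gs‖ ^ 2))
    (vs : ℝ) (hvs : vs = fs - ‖gs‖ ^ 2 / (2 * Ln)) :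
    (∀ c : ℝ, c ∈ Set.Icc (0 : ℝ) 1 →
      (c * Ln / Ls) * as_ + delta - (Ln / 2) * ‖c • (z - x₀)‖ ^ 2
        ≥ (c * Ln / Ls) * taus * (vs - vm)
          + taus * (1 / Ls - 1 / Ln) * ((1 / 2) * ‖gs‖ ^ 2)
          + (Ln * (c - c ^ 2) / 2) * ‖z - x₀‖ ^ 2 ∧
      (c * Ln / Ls) * taus * (vs - vm)
          + taus * (1 / Ls - 1 / Ln) * ((1 / 2) * ‖gs‖ ^ 2)
          + (Ln * (c - c ^ 2) / 2) * ‖z - x₀‖ ^ 2 ≥ 0) ∧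
    (Ln / Ls) * taus ≥ taus := by
  have hLn : 0 < Ln := hLs.trans_le hLsLn
  have hD : 0 ≤ 1 / Ls - 1 / Ln := sub_nonneg.2 (one_div_le_one_div_of_le hLs hLsLn)
  have hratio : 1 ≤ Ln / Ls := (one_le_div hLs).2 hLsLn
  refine ⟨fun c ⟨hc0, hc1⟩ => ⟨?_, ?_⟩, le_mul_of_one_le_left htaus.le hratio⟩
  · have hgap : 0 ≤ (1 - c) * (Ln / Ls) * (taus * (1 / Ls - 1 / Ln) * ((1 / 2) * ‖gs‖ ^ 2)) := by
      have := sub_nonneg.2 hc1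
      positivity
    have hsq : ‖z - x₀‖ ^ 2 = ‖z‖ ^ 2 - 2 * ⟪z, x₀⟫ + ‖x₀‖ ^ 2 := norm_sub_sq_real z x₀
    have hinner : ⟪Ls • (z - x₀), x₀⟫ = Ls * (⟪z, x₀⟫ - ‖x₀‖ ^ 2) := by
      rw [real_inner_smul_left, inner_sub_left, real_inner_self_eq_norm_sq]
    have hnorm : ‖c • (z - x₀)‖ ^ 2 = c ^ 2 * ‖z - x₀‖ ^ 2 := by
      rw [norm_smul, mul_pow, Real.norm_eq_abs, sq_abs]
    rw [ge_iff_le, ← sub_nonneg]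
    convert hgap using 1
    rw [has, hdelta, hvs, hinner, hnorm, hsq]
    field_simp
    ring
  · have hv : 0 ≤ vs - vm := by rw [hvs]; exact sub_nonneg.2 hvm
    have hc : 0 ≤ c - c ^ 2 := by nlinarith
    positivity
end

section
/- Let H be a real inner product space. Let τ_s > 0, 0 < L_s ≤ L_n, f_s ∈ ℝ, g_s, z, x_0 ∈ H, and v_m ∈ ℝ with v_m ≤ f_s − ‖g_s‖²/(2 L_n). Define a_s = τ_s (f_s − ‖g_s‖²/(2 L_s)) + (L_s/2)‖z‖² − (L_s/2)‖x_0‖² − v_m τ_s − ⟨L_s (z − x_0), x_0⟩ and δ = L_n τ_s (1/L_s² − 1/L_n²)(1/2)‖g_s‖². Suppose either z ≠ x_0, or both L_s < L_n and g_s ≠ 0. Then for every c ∈ (0, 1), with κ = c L_n / L_s, one has the strict inequality κ a_s + δ − (L_n/2)‖c (z − x_0)‖² > 0. -/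
open scoped RealInnerProductSpace

/-- Strict feasibility (Slater's condition) for BSPGM's subproblem, Lemma 1(ii):
if z ≠ x₀, or L_s < L_n and g_s ≠ 0, then for every c ∈ (0,1) the cone
constraint holds strictly at (ρ, γ) = (κ e_s, 0). -/
theorem bspgm_subproblem_strict_feasibility {H : Type*} [NormedAddCommGroup H]
    [InnerProductSpace ℝ H]
    (taus : ℝ) (htaus : 0 < taus)
    (Ls Ln : ℝ) (hLs : 0 < Ls) (hLsLn : Ls ≤ Ln)
    (fs : ℝ) (gs z x₀ : H)
    (vm : ℝ) (hvm : vm ≤ fs - ‖gs‖ ^ 2 / (2 * Ln))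
    (as_ : ℝ)
    (has : as_ = taus * (fs - ‖gs‖ ^ 2 / (2 * Ls))
        + (Ls / 2) * ‖z‖ ^ 2 - (Ls / 2) * ‖x₀‖ ^ 2
        - vm * taus - ⟪Ls • (z - x₀), x₀⟫)
    (delta : ℝ)
    (hdelta : delta = Ln * taus * (1 / Ls ^ 2 - 1 / Ln ^ 2) * ((1 / 2) * ‖gs‖ ^ 2))
    (hcase : z ≠ x₀ ∨ (Ls < Ln ∧ gs ≠ 0)) :
    ∀ c : ℝ, c ∈ Set.Ioo (0 : ℝ) 1 →
      0 < (c * Ln / Ls) * as_ + delta - (Ln / 2) * ‖c • (z - x₀)‖ ^ 2 := by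
  rintro c ⟨hc₀, hc₁⟩
  have hLn : 0 < Ln := hLs.trans_le hLsLn
  have hc : 0 < 1 - c := sub_pos.mpr hc₁
  have hnorm : ‖z‖ ^ 2 = ‖z - x₀‖ ^ 2 + 2 * ⟪z - x₀, x₀⟫ + ‖x₀‖ ^ 2 := by
    simpa using norm_add_sq_real (z - x₀) x₀
  have hsmul : ‖c • (z - x₀)‖ ^ 2 = c ^ 2 * ‖z - x₀‖ ^ 2 := by
    rw [norm_smul, mul_pow, Real.norm_eq_abs, sq_abs]
  have hsplit : (c * Ln / Ls) * as_ + delta - (Ln / 2) * ‖c • (z - x₀)‖ ^ 2 =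
      Ln / 2 * (c * (1 - c)) * ‖z - x₀‖ ^ 2
      + taus / 2 * Ln * ((1 / Ls - 1 / Ln) * ((1 - c) / Ls + 1 / Ln)) * ‖gs‖ ^ 2
      + c * Ln / Ls * taus * (fs - ‖gs‖ ^ 2 / (2 * Ln) - vm) := by
    rw [has, hdelta, hsmul, hnorm, real_inner_smul_left]
    field_simp
    ring
  have hgap : 0 ≤ 1 / Ls - 1 / Ln := sub_nonneg.mpr (one_div_le_one_div_of_le hLs hLsLn)
  have hvm' : 0 ≤ fs - ‖gs‖ ^ 2 / (2 * Ln) - vm := sub_nonneg.mpr hvm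
  rw [hsplit]
  rcases hcase with hz | ⟨hlt, hgs⟩
  · have hd : 0 < ‖z - x₀‖ := norm_pos_iff.mpr (sub_ne_zero.mpr hz)
    positivity
  · have hgap' : 0 < 1 / Ls - 1 / Ln := sub_pos.mpr (one_div_lt_one_div_of_lt hLs hlt)
    have hg : 0 < ‖gs‖ := norm_pos_iff.mpr hgs
    positivity
end

section
/- Let H be a real inner product space and let f : H → ℝ be μ-strongly convex with μ > 0, with a minimizer x_star (so f(x_star) ≤ f(x) for all x). Let L > 0, let Δ, Δ' be reals with 0 ≤ Δ' ≤ Δ, let τ, τ' be reals with τ' ≥ τ, and let x_0, x', x'' ∈ H. Assume: (a) f(x_0) − f(x') > 0; (b) τ ≥ 2L/μ + L·Δ/(f(x_0) − f(x')); and (c) f(x'') − f(x_star) ≤ (L/(2τ'))( ‖x_0 − x_star‖² + Δ' ). Then f(x'') − f(x_star) ≤ (1/2)( f(x_0) − f(x_star) ). -/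
open scoped RealInnerProductSpace

/-- Quadratic growth of a strongly convex function away from a minimizer. -/
lemma StrongConvexOn.quadratic_growth {E : Type*} [NormedAddCommGroup E] [NormedSpace ℝ E]
    {s : Set E} {m : ℝ} {f : E → ℝ} (hf : StrongConvexOn s m f) {x y : E}
    (hy : y ∈ s) (hmin : IsMinOn f s y) (hx : x ∈ s) :
    m / 2 * ‖x - y‖ ^ 2 ≤ f x - f y := by
  have hgap : 0 ≤ f x - f y := sub_nonneg.2 (hmin hx)
  refine le_of_forall_lt_imp_le_of_dense fun c hc => ?_
  rcases le_or_gt c 0 with hc0 | hc0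
  · exact hc0.trans hgap
  set q := m / 2 * ‖x - y‖ ^ 2 with hq
  have hqpos : 0 < q := hc0.trans hc
  have ha1 : c / q < 1 := (div_lt_one hqpos).2 hc
  have ha0 : 0 ≤ c / q := by positivity
  have hb0 : 0 < 1 - c / q := sub_pos.2 ha1
  have hconv := hf.2 hx hy hb0.le ha0 (by ring)
  have hle : f y ≤ f ((1 - c / q) • x + (c / q) • y) :=
    hmin (hf.1 hx hy hb0.le ha0 (by ring))
  simp only [smul_eq_mul, ← hq] at hconv
  have hcq : c / q * q = c := div_mul_cancel₀ c hqpos.ne'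
  have hmul : (1 - c / q) * c ≤ (1 - c / q) * (f x - f y) := by
    rw [mul_assoc, hcq] at hconv
    linarith
  exact le_of_mul_le_mul_left hmul hb0

/-- Contraction statement of Theorem 5: once the restart condition holds and the
next serious step satisfies the convergence bound, the objective gap halves. -/
theorem bspgm_restart_contraction {H : Type*} [NormedAddCommGroup H] [InnerProductSpace ℝ H]
    (f : H → ℝ) (mu : ℝ) (hmu : 0 < mu)
    (hsc : StrongConvexOn Set.univ mu f)
    (xstar : H) (hmin : ∀ x : H, f xstar ≤ f x)
    (L : ℝ) (hL : 0 < L)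
    (Delta Delta' : ℝ) (hDelta'0 : 0 ≤ Delta') (hDelta' : Delta' ≤ Delta)
    (tau tau' : ℝ) (htau' : tau ≤ tau')
    (x₀ x' x'' : H)
    (ha : 0 < f x₀ - f x')
    (hb : 2 * L / mu + L * Delta / (f x₀ - f x') ≤ tau)
    (hc : f x'' - f xstar ≤ (L / (2 * tau')) * (‖x₀ - xstar‖ ^ 2 + Delta')) :
    f x'' - f xstar ≤ (1 / 2) * (f x₀ - f xstar) := by
  have hgrowth := hsc.quadratic_growth (Set.mem_univ xstar) (fun x _ => hmin x) (Set.mem_univ x₀)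
  have hDelta : 0 ≤ Delta := hDelta'0.trans hDelta'
  have hgap : f x₀ - f x' ≤ f x₀ - f xstar := by linarith [hmin x']
  have hgap0 : 0 ≤ f x₀ - f xstar := ha.le.trans hgap
  have htau : 0 < tau' := by
    have : 0 < 2 * L / mu + L * Delta / (f x₀ - f x') := by positivity
    linarith
  have hdist : L * ‖x₀ - xstar‖ ^ 2 ≤ 2 * L / mu * (f x₀ - f xstar) := by
    rw [div_mul_eq_mul_div, le_div_iff₀ hmu]
    nlinarith
  have herr : L * Delta' ≤ L * Delta / (f x₀ - f x') * (f x₀ - f xstar) := by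
    calc L * Delta' ≤ L * Delta := by gcongr
      _ = L * Delta / (f x₀ - f x') * (f x₀ - f x') := (div_mul_cancel₀ _ ha.ne').symm
      _ ≤ L * Delta / (f x₀ - f x') * (f x₀ - f xstar) := by gcongr
  have hbound := mul_le_mul_of_nonneg_right (hb.trans htau') hgap0
  refine hc.trans ?_
  rw [div_mul_eq_mul_div, div_le_iff₀ (by positivity)]
  linarith
end

section
/- Fix integers n ≤ N and a real φ_n > 0. Define sequences for n ≤ i ≤ N as follows: ψ_i = (1 + √(1 + 8 φ_i))/2 for n ≤ i ≤ N−1 and ψ_N = √(φ_N); τ_i = φ_i + ψ_i; and φ_{i+1} = τ_i for n ≤ i ≤ N−1. Define β_n = 1/( φ_n (2ψ_n + 1) ) and, recursively, β_i = (1/( φ_i (2ψ_i + 1) )) ( 1 + Σ_{j=n}^{i−1} ψ_j² β_j ) for n < i ≤ N. Then for all indices with n ≤ i < j ≤ N: (1) β_i ≤ 1/( φ_n (2ψ_i + 1) ), and (2) (2ψ_j + 1) β_j ≤ (2ψ_i − 1) β_i. -/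
/-- Lemma 4 (BetaInequalities) of the paper: the inequalities satisfied by the
adversarial sequence β in the subgame perfection construction. -/
theorem beta_inequalities (n N : ℕ) (hnN : n ≤ N)
    (phi psi beta : ℕ → ℝ) (hphin : 0 < phi n)
    (hpsi : ∀ i : ℕ, n ≤ i → i < N →
      psi i = (1 + Real.sqrt (1 + 8 * phi i)) / 2)
    (hpsiN : psi N = Real.sqrt (phi N))
    (hphirec : ∀ i : ℕ, n ≤ i → i < N → phi (i + 1) = phi i + psi i)
    (hbetan : beta n = 1 / (phi n * (2 * psi n + 1)))
    (hbeta : ∀ i : ℕ, n < i → i ≤ N →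
      beta i = (1 / (phi i * (2 * psi i + 1)))
        * (1 + ∑ j ∈ Finset.Ico n i, psi j ^ 2 * beta j)) :
    ∀ i j : ℕ, n ≤ i → i < j → j ≤ N →
      beta i ≤ 1 / (phi n * (2 * psi i + 1)) ∧
      (2 * psi j + 1) * beta j ≤ (2 * psi i - 1) * beta i := by
  have psi_quadratic : ∀ i, n ≤ i → i < N → 0 < phi i →
      1 < psi i ∧ psi i ^ 2 - psi i = 2 * phi i := by
    intro i hni hiN hpos
    have hsq := Real.sq_sqrt (show 0 ≤ 1 + 8 * phi i by linarith)
    have hlt : 1 < Real.sqrt (1 + 8 * phi i) := by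
      rw [Real.lt_sqrt (by norm_num)]
      linarith
    rw [hpsi i hni hiN]
    constructor <;> nlinarith
  have phi_pos : ∀ i, n ≤ i → i ≤ N → 0 < phi i := by
    intro i hni
    induction i, hni using Nat.le_induction with
    | base => exact fun _ => hphin
    | succ k hnk ih =>
      intro hk
      have hpos := ih (by lia)
      have hq := (psi_quadratic k hnk (by lia) hpos).1
      rw [hphirec k hnk (by lia)]
      linarith
  have psi_nonneg : ∀ i, n ≤ i → i ≤ N → 0 ≤ psi i := by
    intro i hni hiN
    rcases hiN.lt_or_eq with h | rfl
    · linarith [(psi_quadratic i hni h (phi_pos i hni hiN)).1]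
    · exact hpsiN ▸ Real.sqrt_nonneg _
  have beta_mul : ∀ i, n ≤ i → i ≤ N →
      phi i * ((2 * psi i + 1) * beta i) = 1 + ∑ j ∈ Finset.Ico n i, psi j ^ 2 * beta j := by
    intro i hni hiN
    have h1 := phi_pos i hni hiN
    have h2 : 0 < 2 * psi i + 1 := by linarith [psi_nonneg i hni hiN]
    rcases hni.eq_or_lt with rfl | h
    · rw [hbetan, Finset.Ico_self, Finset.sum_empty]
      field_simp
      ring
    · rw [hbeta i h hiN]
      field_simp
  -- For consecutive indices the second inequality is an equality.
  have beta_succ : ∀ i, n ≤ i → i < N →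
      (2 * psi (i + 1) + 1) * beta (i + 1) = (2 * psi i - 1) * beta i := by
    intro i hni hiN
    have hi := beta_mul i hni hiN.le
    have hs := beta_mul (i + 1) (by lia) hiN
    have hpos := phi_pos (i + 1) (by lia) hiN
    have hq := (psi_quadratic i hni hiN (phi_pos i hni hiN.le)).2
    rw [Finset.sum_Ico_succ_top hni, ← add_assoc, ← hi] at hs
    apply mul_left_cancel₀ hpos.ne'
    rw [hs, hphirec i hni hiN]
    linear_combination -beta i * hq
  have beta_pos : ∀ i, n ≤ i → i ≤ N → 0 < beta i := by
    intro i hni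
    induction i, hni using Nat.le_induction with
    | base =>
      intro h
      have := psi_nonneg n le_rfl h
      rw [hbetan]
      positivity
    | succ k hnk ih =>
      intro hk
      have hq := (psi_quadratic k hnk (by lia) (phi_pos k hnk (by lia))).1
      have hs := psi_nonneg (k + 1) (by lia) hk
      refine pos_of_mul_pos_right (a := 2 * psi (k + 1) + 1) ?_ (by linarith)
      rw [beta_succ k hnk (by lia)]
      exact mul_pos (by linarith) (ih (by lia))
  have beta_anti : ∀ i j, n ≤ i → i ≤ j → j ≤ N →
      (2 * psi j + 1) * beta j ≤ (2 * psi i + 1) * beta i := by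
    intro i j hni hij
    induction j, hij using Nat.le_induction with
    | base => exact fun _ => le_rfl
    | succ k hik ih =>
      intro hk
      have hb := beta_pos k (by lia) (by lia)
      linarith [ih (by lia), beta_succ k (by lia) (by lia)]
  intro i j hni hij hjN
  have hpsi_i := psi_nonneg i hni (by lia)
  constructor
  · have hn := beta_mul n le_rfl hnN
    rw [Finset.Ico_self, Finset.sum_empty, add_zero] at hn
    have ha := mul_le_mul_of_nonneg_left (beta_anti n i le_rfl hni (by lia)) hphin.le
    rw [le_div_iff₀ (by positivity)]
    linarith
  · rw [← beta_succ i hni (by lia)]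
    exact beta_anti (i + 1) j (by lia) hij hjN
end

section
/- Fix integers n ≤ N and a real φ_n > 0, and define φ_i, ψ_i, τ_i, β_i for n ≤ i ≤ N as follows: ψ_i = (1 + √(1 + 8 φ_i))/2 for i ≤ N−1 and ψ_N = √(φ_N); τ_i = φ_i + ψ_i; φ_{i+1} = τ_i; β_n = 1/( φ_n (2ψ_n + 1) ); and β_i = (1/( φ_i (2ψ_i + 1) )) ( 1 + Σ_{j=n}^{i−1} ψ_j² β_j ) for i > n. Then for every i with n ≤ i ≤ N−1 one has the identity (2 ψ_{i+1} + 1) β_{i+1} = (2 ψ_i − 1) β_i. -/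
/-- The key recursion inside the proof of Lemma 4 (BetaInequalities):
(2ψ_{i+1} + 1)β_{i+1} = (2ψ_i − 1)β_i. -/
theorem beta_recursion_identity (n N : ℕ) (hnN : n ≤ N)
    (phi psi beta : ℕ → ℝ) (hphin : 0 < phi n)
    (hpsi : ∀ i : ℕ, n ≤ i → i < N →
      psi i = (1 + Real.sqrt (1 + 8 * phi i)) / 2)
    (hpsiN : psi N = Real.sqrt (phi N))
    (hphirec : ∀ i : ℕ, n ≤ i → i < N → phi (i + 1) = phi i + psi i)
    (hbetan : beta n = 1 / (phi n * (2 * psi n + 1)))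
    (hbeta : ∀ i : ℕ, n < i → i ≤ N →
      beta i = (1 / (phi i * (2 * psi i + 1)))
        * (1 + ∑ j ∈ Finset.Ico n i, psi j ^ 2 * beta j)) :
    ∀ i : ℕ, n ≤ i → i < N →
      (2 * psi (i + 1) + 1) * beta (i + 1) = (2 * psi i - 1) * beta i := by
  have phi_pos : ∀ i, n ≤ i → i ≤ N → 0 < phi i := by
    intro i hi
    induction i, hi using Nat.le_induction with
    | base => exact fun _ => hphin
    | succ i hi ih =>
      intro hiN
      have hphi := ih (by omega)
      rw [hphirec i hi hiN, hpsi i hi hiN]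
      positivity
  have psi_nonneg : ∀ i, n ≤ i → i ≤ N → 0 ≤ psi i := by
    intro i hi hiN
    rcases hiN.lt_or_eq with h | rfl
    · rw [hpsi i hi h]
      positivity
    · rw [hpsiN]
      positivity
  have beta_mul : ∀ i, n ≤ i → i ≤ N → phi i * (2 * psi i + 1) * beta i
      = 1 + ∑ j ∈ Finset.Ico n i, psi j ^ 2 * beta j := by
    intro i hi hiN
    have hphi := phi_pos i hi hiN
    have hpsi_nonneg := psi_nonneg i hi hiN
    have hne : phi i * (2 * psi i + 1) ≠ 0 := by positivity
    rcases hi.eq_or_lt with rfl | h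
    · rw [hbetan, mul_one_div_cancel hne]
      simp
    · rw [hbeta i h hiN, ← mul_assoc, mul_one_div_cancel hne, one_mul]
  intro i hi hiN
  have hphi := phi_pos i hi hiN.le
  have psi_sq : psi i ^ 2 = psi i + 2 * phi i := by
    have hsq := Real.sq_sqrt (show 0 ≤ 1 + 8 * phi i by positivity)
    rw [hpsi i hi hiN]
    linear_combination hsq / 4
  have hcur := beta_mul i hi hiN.le
  have hnext := beta_mul (i + 1) (by omega) hiN
  rw [Finset.sum_Ico_succ_top hi] at hnext
  apply mul_left_cancel₀ (phi_pos (i + 1) (by omega) hiN).ne'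
  linear_combination hnext - hcur - (2 * psi i - 1) * beta i * hphirec i hi hiN
    - beta i * psi_sq
end
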